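/- Let P(x) = ∑_{1 ≤ |α| ≤ d} λ_α x^α be a real polynomial on ℝⁿ, let φ be a C¹ function on the closed unit ball U of ℝⁿ, and let V be a convex subset of U. Then there is a constant C depending only on n and d such that |∫_V e^{iP(x)} φ(x) dx| ≤ C |λ|^{-1/d} sup_{x ∈ U} (|φ(x)| + |∇φ(x)|), where |λ| = ∑_{1 ≤ |α| ≤ d} |λ_α|. -/

import Mathlib

open MeasureTheory Set

/-- Degree of a multi-index `α : Fin n → Fin (d+1)`. -/
def mdeg {n d : ℕ} (α : Fin n → Fin (d + 1)) : ℕ := ∑ i, (α i : ℕ)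

/-- The polynomial `P(x) = ∑_α λ_α x^α`. -/
noncomputable def mpoly {n d : ℕ} (lam : (Fin n → Fin (d + 1)) → ℝ)
    (x : EuclideanSpace ℝ (Fin n)) : ℝ :=
  ∑ α : Fin n → Fin (d + 1), lam α * ∏ i, x i ^ (α i : ℕ)

/-- One-dimensional sublevel set estimate via factorization over the complex numbers. -/
theorem vdc_remez (m : ℕ) (p : Polynomial ℂ) (hp : p.natDegree ≤ m) (ε : ℝ) (hε : 0 < ε) :
    volume {s : ℝ | s ∈ Icc (0:ℝ) 1 ∧ ‖p.eval (s:ℂ)‖ < ε ^ m * ‖p.eval 0‖}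
      ≤ ENNReal.ofReal ((4 * m + 2) * ε) := by
  classical
  rcases le_or_gt (1/2) ε with h | h
  · calc _ ≤ volume (Icc (0:ℝ) 1) := measure_mono (fun s hs => hs.1)
      _ = ENNReal.ofReal 1 := by simp
      _ ≤ _ := by
        apply ENNReal.ofReal_le_ofReal
        have : (0:ℝ) ≤ 4 * m := by positivity
        nlinarith
  · have hsub : {s : ℝ | s ∈ Icc (0:ℝ) 1 ∧ ‖p.eval (s:ℂ)‖ < ε ^ m * ‖p.eval 0‖}
        ⊆ ⋃ z ∈ p.roots.toFinset, Metric.ball z.re (2 * ε) := by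
      rintro s ⟨hs, hlt⟩
      by_contra hcon
      have hz : ∀ z ∈ p.roots, ε * ‖z‖ ≤ ‖(s:ℂ) - z‖ := by
        intro z hz
        by_contra hc
        push Not at hc
        apply hcon
        simp only [mem_iUnion]
        refine ⟨z, by simpa using hz, ?_⟩
        have h1 : ‖z‖ ≤ ‖(s:ℂ) - z‖ + ‖(s:ℂ)‖ := by
          have := norm_sub_le (s:ℂ) ((s:ℂ) - z)
          simp only [sub_sub_cancel] at this
          linarith
        have h2 : ‖(s:ℂ)‖ ≤ 1 := by
          rw [Complex.norm_real, Real.norm_eq_abs, abs_le]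
          constructor <;> linarith [hs.1, hs.2]
        have h3 : ‖z‖ < 2 := by nlinarith [norm_nonneg z]
        have h4 : |s - z.re| ≤ ‖(s:ℂ) - z‖ := by
          have := Complex.abs_re_le_norm ((s:ℂ) - z)
          simpa using this
        rw [Metric.mem_ball, Real.dist_eq]
        nlinarith [norm_nonneg z]
      have hprod := Multiset.prod_map_le_prod_map₀ (s := p.roots) (fun z => ε * ‖z‖)
        (fun z => ‖(s:ℂ) - z‖) (fun z _ => by positivity) hz
      rw [Multiset.prod_map_mul, Multiset.map_const', Multiset.prod_replicate] at hprod
      have e1 : ∀ w : ℂ, ‖p.eval w‖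
          = ‖p.leadingCoeff‖ * (p.roots.map (fun z => ‖w - z‖)).prod := by
        intro w
        rw [(IsAlgClosed.splits p).eval_eq_prod_roots w, norm_mul]
        congr 1
        generalize p.roots = R
        induction R using Multiset.induction_on with
        | empty => simp
        | cons a R ih => simp [ih]
      rw [e1, e1] at hlt
      simp only [zero_sub, norm_neg] at hlt
      have hk : ε ^ m ≤ ε ^ (Multiset.card p.roots) :=
        pow_le_pow_of_le_one hε.le (by linarith) ((p.card_roots').trans hp)
      have hnn : 0 ≤ (p.roots.map (fun z => ‖z‖)).prod :=
        Multiset.prod_nonneg (by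
          intro a ha
          obtain ⟨z, _, rfl⟩ := Multiset.mem_map.1 ha
          positivity)
      have := mul_le_mul_of_nonneg_right hk hnn
      have h5 := mul_le_mul_of_nonneg_left (this.trans hprod) (norm_nonneg p.leadingCoeff)
      nlinarith
    calc _ ≤ _ := measure_mono hsub
      _ ≤ ∑ z ∈ p.roots.toFinset, volume (Metric.ball z.re (2 * ε)) :=
        measure_biUnion_finset_le _ _
      _ = ∑ z ∈ p.roots.toFinset, ENNReal.ofReal (2 * (2 * ε)) := by simp [Real.volume_ball]
      _ = ENNReal.ofReal (p.roots.toFinset.card * (2 * (2 * ε))) := by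
        rw [Finset.sum_const, nsmul_eq_mul, ENNReal.ofReal_mul (by positivity)]; simp
      _ ≤ _ := by
        apply ENNReal.ofReal_le_ofReal
        have : (p.roots.toFinset.card : ℝ) ≤ m := by
          exact_mod_cast (Multiset.toFinset_card_le _).trans ((p.card_roots').trans hp)
        nlinarith

theorem vdc_arctan (z : ℂ) (a b : ℝ) :
    Continuous (fun t : ℝ => |z.im| / ((t - z.re) ^ 2 + z.im ^ 2)) ∧
    ∫ t in a..b, |z.im| / ((t - z.re) ^ 2 + z.im ^ 2) ≤ Real.pi := by
  by_cases hz : z.im = 0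
  · simp [hz, Real.pi_pos.le, continuous_const]
  have hpos : ∀ t : ℝ, 0 < (t - z.re) ^ 2 + z.im ^ 2 := fun t => by positivity
  have hc : Continuous (fun t : ℝ => |z.im| / ((t - z.re) ^ 2 + z.im ^ 2)) :=
    Continuous.div (by fun_prop) (by fun_prop) (fun t => (hpos t).ne')
  refine ⟨hc, ?_⟩
  have hd : ∀ t : ℝ, HasDerivAt (fun t : ℝ => Real.arctan ((t - z.re) / |z.im|))
      (|z.im| / ((t - z.re) ^ 2 + z.im ^ 2)) t := by
    intro t
    have h1 : HasDerivAt (fun t : ℝ => (t - z.re) / |z.im|) (1 / |z.im|) t :=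
      ((hasDerivAt_id t).sub_const _).div_const _
    convert h1.arctan using 1
    have : |z.im| ≠ 0 := by simpa using hz
    have h2 := hpos t
    have h3 : 1 + ((t - z.re) / |z.im|) ^ 2 = ((t - z.re) ^ 2 + z.im ^ 2) / |z.im| ^ 2 := by
      rw [div_pow, ← sq_abs z.im]; field_simp; ring
    rw [h3]; field_simp
  rw [intervalIntegral.integral_eq_sub_of_hasDerivAt (fun t _ => hd t) (hc.intervalIntegrable _ _)]
  linarith [Real.arctan_lt_pi_div_two ((b - z.re) / |z.im|),
    Real.neg_pi_div_two_lt_arctan ((a - z.re) / |z.im|)]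

theorem vdc_arctan_sum (R : Multiset ℂ) (a b : ℝ) :
    Continuous (fun t : ℝ => (R.map (fun z => |z.im| / ((t - z.re) ^ 2 + z.im ^ 2))).sum) ∧
    ∫ t in a..b, (R.map (fun z => |z.im| / ((t - z.re) ^ 2 + z.im ^ 2))).sum
      ≤ (Multiset.card R) * Real.pi := by
  induction R using Multiset.induction_on with
  | empty => simp [continuous_const]
  | cons z R ih =>
    obtain ⟨h1, h2⟩ := ih
    obtain ⟨h3, h4⟩ := vdc_arctan z a b
    simp only [Multiset.map_cons, Multiset.sum_cons, Multiset.card_cons]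
    refine ⟨h3.add h1, ?_⟩
    rw [intervalIntegral.integral_add (h3.intervalIntegrable _ _) (h1.intervalIntegrable _ _)]
    push_cast
    linarith

/-- Logarithmic derivative bound. -/
theorem vdc_logderiv (d : ℕ) (q : Polynomial ℝ) (hq : q.natDegree ≤ d) (μ : ℝ) (hμ : 0 < μ)
    (a b : ℝ) (hab : a ≤ b) :
    ∫ t in a..b, |q.derivative.eval t| / ((q.eval t) ^ 2 + μ ^ 2) ≤ d * Real.pi / μ := by
  set r : Polynomial ℂ := q.map (algebraMap ℝ ℂ) - Polynomial.C (Complex.I * μ) with hr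
  have hrdeg : r.natDegree ≤ d := by
    rw [hr, Polynomial.natDegree_sub_C]
    exact (Polynomial.natDegree_map_le).trans hq
  have hev : ∀ t : ℝ, r.eval (t:ℂ) = (q.eval t : ℝ) - Complex.I * μ := by
    intro t
    simp only [hr, Polynomial.eval_sub, Polynomial.eval_C]
    congr 1
    rw [Polynomial.eval_map]
    exact Polynomial.eval₂_at_apply (algebraMap ℝ ℂ) t
  have hdev : ∀ t : ℝ, r.derivative.eval (t:ℂ) = (q.derivative.eval t : ℝ) := by
    intro t
    simp only [hr, Polynomial.derivative_sub, Polynomial.derivative_C, sub_zero,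
      Polynomial.derivative_map]
    rw [Polynomial.eval_map]
    exact Polynomial.eval₂_at_apply (algebraMap ℝ ℂ) t
  have hne : ∀ t : ℝ, r.eval (t:ℂ) ≠ 0 := by
    intro t h
    rw [hev] at h
    have := congrArg Complex.im h
    simp at this
    exact hμ.ne' this
  have hpt : ∀ t : ℝ, |q.derivative.eval t| / ((q.eval t) ^ 2 + μ ^ 2)
      ≤ (r.roots.map (fun z => |z.im| / ((t - z.re) ^ 2 + z.im ^ 2))).sum * μ⁻¹ := by
    intro t
    have h1 := (IsAlgClosed.splits r).eval_derivative_div_eval_of_ne_zero (hne t)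
    have h2 := congrArg Complex.im h1
    have h3 : ∀ R : Multiset ℂ, |((R.map (fun z => 1 / ((t:ℂ) - z))).sum).im| ≤
        (R.map (fun z => |z.im| / ((t - z.re) ^ 2 + z.im ^ 2))).sum := by
      intro R
      induction R using Multiset.induction_on with
      | empty => simp
      | cons z R ih =>
        simp only [Multiset.map_cons, Multiset.sum_cons, Complex.add_im]
        refine (abs_add_le _ _).trans (add_le_add (le_of_eq ?_) ih)
        rw [one_div, Complex.inv_im, Complex.normSq_apply]
        simp only [Complex.sub_im, Complex.ofReal_im, Complex.sub_re, Complex.ofReal_re]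
        rw [show -(0 - z.im) = z.im by ring, abs_div]
        congr 1
        rw [abs_of_nonneg (by nlinarith [mul_self_nonneg (t - z.re), mul_self_nonneg (z.im)])]
        ring
    have h4 := h3 r.roots
    rw [← h2, hdev, hev] at h4
    have h5 : (((q.derivative.eval t : ℝ) : ℂ) / ((q.eval t : ℝ) - Complex.I * μ)).im
        = q.derivative.eval t * μ / ((q.eval t) ^ 2 + μ ^ 2) := by
      rw [Complex.div_im, Complex.normSq_apply]
      simp
      ring_nf
    rw [h5, abs_div, abs_mul, abs_of_pos hμ,
      abs_of_pos (show 0 < (q.eval t) ^ 2 + μ ^ 2 by positivity)] at h4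
    rw [← div_eq_mul_inv, le_div_iff₀ hμ]
    calc _ = _ := by ring
      _ ≤ _ := h4
  obtain ⟨hc, hi⟩ := vdc_arctan_sum r.roots a b
  calc _ ≤ ∫ t in a..b, (r.roots.map (fun z => |z.im| / ((t - z.re) ^ 2 + z.im ^ 2))).sum * μ⁻¹ := by
        apply intervalIntegral.integral_mono_on hab _ _ (fun t _ => hpt t)
        · apply Continuous.intervalIntegrable
          exact Continuous.div (by fun_prop) (by fun_prop) (fun t => by positivity)
        · exact (hc.mul continuous_const).intervalIntegrable _ _
    _ ≤ _ := by
      rw [intervalIntegral.integral_mul_const, div_eq_mul_inv]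
      have : (Multiset.card r.roots : ℝ) ≤ d := by exact_mod_cast (r.card_roots').trans hrdeg
      have := mul_le_mul_of_nonneg_right this Real.pi_pos.le
      exact mul_le_mul_of_nonneg_right (hi.trans this) (by positivity)

/-- A `C¹` truncation of `1/u`. -/
noncomputable def vdcG (u : ℝ) : ℝ := if |u| ≤ 1 then 2 * u - u ^ 3 else u⁻¹

/-- Its derivative. -/
noncomputable def vdcH (u : ℝ) : ℝ := if |u| ≤ 1 then 2 - 3 * u ^ 2 else -(u ^ 2)⁻¹

theorem vdcG_hasDerivAt (u : ℝ) : HasDerivAt vdcG (vdcH u) u := by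
  have hin : ∀ v : ℝ, HasDerivAt (fun u : ℝ => 2 * u - u ^ 3) (2 - 3 * v ^ 2) v := by
    intro v
    have h := ((hasDerivAt_id v).const_mul 2).sub (hasDerivAt_pow 3 v)
    have e : (2:ℝ) * 1 - (3:ℕ) * v ^ (3 - 1) = 2 - 3 * v ^ 2 := by norm_num
    rw [e] at h
    exact h
  have hout : ∀ v : ℝ, v ≠ 0 → HasDerivAt (fun u : ℝ => u⁻¹) (-(v ^ 2)⁻¹) v :=
    fun v hv => hasDerivAt_inv hv
  rcases lt_trichotomy |u| 1 with h | h | h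
  · have h1 : vdcG =ᶠ[nhds u] (fun u : ℝ => 2 * u - u ^ 3) := by
      filter_upwards [(continuous_abs.tendsto u).eventually (gt_mem_nhds h)] with v hv
      simp [vdcG, hv.le]
    rw [vdcH, if_pos h.le]
    exact (hin u).congr_of_eventuallyEq h1
  · have hu0 : u ≠ 0 := by rintro rfl; simp at h
    have hu2 : u ^ 2 = 1 := by rw [← sq_abs, h]; norm_num
    have e1 : vdcH u = 2 - 3 * u ^ 2 := by rw [vdcH, if_pos h.le]
    have e2 : vdcH u = -(u ^ 2)⁻¹ := by rw [e1, hu2]; norm_num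
    have e3 : vdcG u = 2 * u - u ^ 3 := by rw [vdcG, if_pos h.le]
    have e4 : vdcG u = u⁻¹ := by
      rw [e3]; field_simp; nlinarith
    have w1 : HasDerivWithinAt vdcG (vdcH u) {v | |v| ≤ 1} u := by
      rw [e1]
      exact (hin u).hasDerivWithinAt.congr (fun v hv => by simp only [vdcG]; exact if_pos hv) e3
    have w2 : HasDerivWithinAt vdcG (vdcH u) {v | ¬ |v| ≤ 1} u := by
      rw [e2]
      exact (hout u hu0).hasDerivWithinAt.congr
        (fun v hv => by simp only [vdcG]; exact if_neg hv) e4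
    have := w1.union w2
    have hun : {v : ℝ | |v| ≤ 1} ∪ {v | ¬ |v| ≤ 1} = univ := by
      ext v; simp [le_or_gt]
    rw [hun] at this
    exact hasDerivWithinAt_univ.1 this
  · have hu0 : u ≠ 0 := by rintro rfl; simp at h; linarith
    have h1 : vdcG =ᶠ[nhds u] (fun u : ℝ => u⁻¹) := by
      filter_upwards [(continuous_abs.tendsto u).eventually (lt_mem_nhds h)] with v hv
      simp only [vdcG]; rw [if_neg (not_le.2 hv)]
    rw [vdcH, if_neg (not_le.2 h)]
    exact (hout u hu0).congr_of_eventuallyEq h1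

theorem vdcG_continuous : Continuous vdcG :=
  continuous_iff_continuousAt.2 fun u => (vdcG_hasDerivAt u).continuousAt

theorem vdcH_continuous : Continuous vdcH := by
  have : vdcH = fun u : ℝ => 2 - 3 * (min |u| 1) ^ 2 - ((max |u| 1) ^ 2)⁻¹ + 1 := by
    funext u
    unfold vdcH
    split_ifs with h
    · rw [min_eq_left h, max_eq_right h]; simp
    · push Not at h
      rw [min_eq_right h.le, max_eq_left h.le, sq_abs]; ring
  rw [this]
  have h : ∀ u : ℝ, (max |u| 1) ^ 2 ≠ 0 := fun u => by
    have := le_max_right |u| 1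
    positivity
  have : Continuous fun u : ℝ => ((max |u| 1) ^ 2)⁻¹ := Continuous.inv₀ (by fun_prop) h
  fun_prop

theorem vdcG_abs_le (u : ℝ) : |vdcG u| ≤ 2 := by
  unfold vdcG
  split_ifs with h
  · rw [abs_le] at *
    constructor
    · nlinarith [mul_nonneg (sq_nonneg u) (by linarith : (0:ℝ) ≤ 1 - u), sq_nonneg u]
    · nlinarith [mul_nonneg (sq_nonneg u) (by linarith : (0:ℝ) ≤ 1 + u), sq_nonneg u]
  · push Not at h
    rw [abs_inv]
    have := inv_le_one_of_one_le₀ h.le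
    linarith

theorem vdcH_abs_le (u : ℝ) : |vdcH u| ≤ 4 / (u ^ 2 + 1) := by
  unfold vdcH
  rw [le_div_iff₀ (by positivity)]
  split_ifs with h
  · have h2 : u ^ 2 ≤ 1 := by rw [← sq_abs]; exact pow_le_one₀ (abs_nonneg _) h
    have : |2 - 3 * u ^ 2| ≤ 2 := by rw [abs_le]; constructor <;> nlinarith [sq_nonneg u]
    nlinarith [sq_nonneg u, abs_nonneg (2 - 3 * u ^ 2)]
  · push Not at h
    have h2 : 1 < u ^ 2 := by rw [← sq_abs]; exact one_lt_pow₀ h (by norm_num)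
    rw [abs_neg, abs_of_pos (by positivity), inv_mul_le_iff₀ (by positivity)]
    nlinarith

theorem vdcG_one_sub (u : ℝ) : |1 - u * vdcG u| ≤ if |u| < 1 then 1 else 0 := by
  unfold vdcG
  rcases lt_trichotomy |u| 1 with h | h | h
  · rw [if_pos h, if_pos h.le]
    have h2 : u ^ 2 ≤ 1 := by rw [← sq_abs]; exact pow_le_one₀ (abs_nonneg _) h.le
    rw [show 1 - u * (2 * u - u ^ 3) = (1 - u ^ 2) ^ 2 by ring, abs_of_nonneg (by positivity)]
    exact pow_le_one₀ (by linarith) (by nlinarith [sq_nonneg u])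
  · have hu2 : u ^ 2 = 1 := by rw [← sq_abs, h]; norm_num
    rw [if_pos h.le, show 1 - u * (2 * u - u ^ 3) = (1 - u ^ 2) ^ 2 by ring, hu2]
    simp [h]
  · have hu0 : u ≠ 0 := by rintro rfl; simp at h; linarith
    rw [if_neg (not_le.2 h), mul_inv_cancel₀ hu0]
    simp [not_lt.2 h.le]

/-- One-dimensional estimate. -/
theorem vdc_oneD (d : ℕ) (p : Polynomial ℝ) (hp : p.natDegree ≤ d) (μ : ℝ) (hμ : 0 < μ)
    (a b : ℝ) (hab : a ≤ b) (hab2 : b - a ≤ 2) (ψ : ℝ → ℝ) (B : ℝ)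
    (hψc : ContinuousOn ψ (Icc a b)) (hψd : ∀ t ∈ Ioo a b, DifferentiableAt ℝ ψ t)
    (hψB : ∀ t ∈ Icc a b, |ψ t| ≤ B) (hψB' : ∀ t ∈ Ioo a b, |deriv ψ t| ≤ B) :
    ‖∫ t in a..b, Complex.exp (Complex.I * ((p.eval t : ℝ) : ℂ)) * ((ψ t : ℝ) : ℂ)‖
      ≤ B * ((8 + 4 * Real.pi * d) / μ)
        + B * volume.real {t | t ∈ Icc a b ∧ |p.derivative.eval t| < μ} := by
  have hB : 0 ≤ B := (abs_nonneg _).trans (hψB a ⟨le_rfl, hab⟩)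
  set q := p.derivative with hq
  have hqdeg : q.natDegree ≤ d := (Polynomial.natDegree_derivative_le p).trans (by omega)
  set g : ℝ → ℝ := fun t => μ⁻¹ * vdcG (q.eval t / μ) with hg
  set g' : ℝ → ℝ := fun t => μ⁻¹ * (vdcH (q.eval t / μ) * (q.derivative.eval t / μ)) with hg'
  set e : ℝ → ℂ := fun t => Complex.exp (Complex.I * ((p.eval t : ℝ) : ℂ)) with he
  have henorm : ∀ t, ‖e t‖ = 1 := by
    intro t
    simp only [he]
    rw [mul_comm, Complex.norm_exp_ofReal_mul_I]
  have hec : Continuous e := by fun_prop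
  have hed : ∀ t, HasDerivAt e (Complex.I * (q.eval t : ℝ) * e t) t := by
    intro t
    have h1 : HasDerivAt (fun t : ℝ => ((p.eval t : ℝ) : ℂ)) ((q.eval t : ℝ) : ℂ) t :=
      (p.hasDerivAt t).ofReal_comp
    have := (h1.const_mul Complex.I).cexp
    convert this using 1
    simp only [he]; ring
  have hgd : ∀ t, HasDerivAt g (g' t) t := by
    intro t
    exact ((vdcG_hasDerivAt _).comp t ((q.hasDerivAt t).div_const μ)).const_mul μ⁻¹
  have hgc : Continuous g := continuous_const.mul (vdcG_continuous.comp (by fun_prop))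
  have hgc' : Continuous g' :=
    continuous_const.mul ((vdcH_continuous.comp (by fun_prop)).mul (by fun_prop))
  have hgle : ∀ t, |g t| ≤ 2 / μ := by
    intro t
    simp only [hg]
    rw [abs_mul, abs_of_pos (by positivity : 0 < μ⁻¹), div_eq_mul_inv, mul_comm]
    exact mul_le_mul_of_nonneg_right (vdcG_abs_le _) (by positivity)
  have hgle' : ∀ t, |g' t| ≤ 4 * (|q.derivative.eval t| / ((q.eval t) ^ 2 + μ ^ 2)) := by
    intro t
    simp only [hg']
    rw [abs_mul, abs_mul, abs_div, abs_of_pos (by positivity : 0 < μ⁻¹), abs_of_pos hμ]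
    have h1 := vdcH_abs_le (q.eval t / μ)
    have h2 : 4 / ((q.eval t / μ) ^ 2 + 1) = 4 * μ ^ 2 / ((q.eval t) ^ 2 + μ ^ 2) := by
      field_simp
    rw [h2] at h1
    calc _ ≤ μ⁻¹ * (4 * μ ^ 2 / ((q.eval t) ^ 2 + μ ^ 2) * (|q.derivative.eval t| / μ)) := by
          gcongr
      _ = _ := by field_simp
  have hnb : ∀ᵐ t : ℝ, t ≠ b := compl_mem_ae_iff.2 (measure_singleton b)
  have hψi : IntervalIntegrable (deriv ψ) volume a b := by
    rw [intervalIntegrable_iff_integrableOn_Ioc_of_le hab]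
    refine Measure.integrableOn_of_bounded (M := B) (by simp)
      (measurable_deriv ψ).aestronglyMeasurable ?_
    rw [ae_restrict_iff' measurableSet_Ioc]
    filter_upwards [hnb] with t ht htm
    exact hψB' t ⟨htm.1, lt_of_le_of_ne htm.2 ht⟩
  have huIcc : uIcc a b = Icc a b := uIcc_of_le hab
  have hψc' : ContinuousOn ψ (uIcc a b) := by rwa [huIcc]
  set v : ℝ → ℂ := fun t => ((g t * ψ t : ℝ) : ℂ) with hv
  set v' : ℝ → ℂ := fun t => ((g' t * ψ t + g t * deriv ψ t : ℝ) : ℂ) with hv'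
  have hvi : IntervalIntegrable (fun t => g' t * ψ t + g t * deriv ψ t) volume a b :=
    ((hgc'.continuousOn.mul hψc').intervalIntegrable).add
      (hψi.continuousOn_mul hgc.continuousOn)
  have hvi' : IntervalIntegrable v' volume a b := by
    rw [intervalIntegrable_iff_integrableOn_Ioc_of_le hab] at hvi ⊢
    exact hvi.ofReal
  have hvc : ContinuousOn v (uIcc a b) :=
    Complex.continuous_ofReal.comp_continuousOn (hgc.continuousOn.mul hψc')
  have hparts := intervalIntegral.integral_mul_deriv_eq_deriv_mul_of_hasDerivAt
    (u := v) (v := e) (u' := v') (v' := fun t => Complex.I * (q.eval t : ℝ) * e t)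
    hvc hec.continuousOn
    (fun t ht => by
      rw [min_eq_left hab, max_eq_right hab] at ht
      exact ((hgd t).mul (hψd t ht).hasDerivAt).ofReal_comp)
    (fun t _ => hed t) hvi'
    ((by fun_prop : Continuous fun t => Complex.I * (q.eval t : ℝ) * e t).intervalIntegrable _ _)
  -- the splitting
  set w : ℝ → ℂ := fun t => ((1 - (q.eval t) * g t : ℝ) : ℂ) * (e t * (ψ t : ℂ)) with hw
  have hψC : ContinuousOn (fun t => (ψ t : ℂ)) (uIcc a b) :=
    Complex.continuous_ofReal.comp_continuousOn hψc'
  have hwc : ContinuousOn w (uIcc a b) := by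
    refine ContinuousOn.mul ?_ (hec.continuousOn.mul hψC)
    exact (Complex.continuous_ofReal.comp (by fun_prop)).continuousOn
  have hvuc : ContinuousOn (fun t => v t * (Complex.I * (q.eval t : ℝ) * e t)) (uIcc a b) :=
    hvc.mul (by fun_prop : Continuous fun t => Complex.I * (q.eval t : ℝ) * e t).continuousOn
  have hsplit : ∫ t in a..b, e t * (ψ t : ℂ) = (∫ t in a..b, w t)
      + (-Complex.I) * ∫ t in a..b, v t * (Complex.I * (q.eval t : ℝ) * e t) := by
    have hvi2 : IntervalIntegrable
        (fun t => -Complex.I * (v t * (Complex.I * (q.eval t : ℝ) * e t))) volume a b :=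
      (continuousOn_const.mul hvuc).intervalIntegrable
    rw [← intervalIntegral.integral_const_mul, ← intervalIntegral.integral_add
      hwc.intervalIntegrable hvi2]
    congr 1
    funext t
    simp only [hw, hv]
    push_cast
    linear_combination ((g t : ℂ) * (ψ t) * (q.eval t : ℝ) * e t) * Complex.I_sq
  set S : Set ℝ := {t | t ∈ Icc a b ∧ |q.eval t| < μ} with hS
  have hSm : MeasurableSet S := by
    refine measurableSet_Icc.inter ?_
    exact (isOpen_lt (f := fun t : ℝ => |q.eval t|) (g := fun _ => μ)
      (by fun_prop) continuous_const).measurableSet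
  have hSfin : volume S ≠ ⊤ :=
    ((measure_mono (fun t ht => ht.1)).trans_lt (measure_Icc_lt_top (a := a) (b := b))).ne
  have hbw : ‖∫ t in a..b, w t‖ ≤ B * volume.real S := by
    have h1 : ‖∫ t in a..b, w t‖ ≤ ∫ t in a..b, S.indicator (fun _ => B) t := by
      refine intervalIntegral.norm_integral_le_of_norm_le hab ?_ ?_
      · refine Filter.Eventually.of_forall fun t ht => ?_
        have ht' : t ∈ Icc a b := Ioc_subset_Icc_self ht
        simp only [hw]
        rw [norm_mul, norm_mul, henorm, one_mul, Complex.norm_real, Complex.norm_real]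
        have h2 := vdcG_one_sub (q.eval t / μ)
        have h3 : 1 - q.eval t * g t = 1 - q.eval t / μ * vdcG (q.eval t / μ) := by
          simp only [hg]; ring
        rw [h3, Real.norm_eq_abs, Real.norm_eq_abs]
        simp only [abs_div, abs_of_pos hμ, div_lt_one hμ] at h2
        by_cases hlt : |q.eval t| < μ
        · rw [if_pos hlt] at h2
          rw [indicator_of_mem (show t ∈ S from ⟨ht', hlt⟩)]
          calc _ ≤ 1 * B := mul_le_mul h2 (hψB t ht') (abs_nonneg _) zero_le_one
            _ = B := one_mul _
        · rw [if_neg hlt] at h2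
          rw [indicator_of_notMem (fun h => hlt h.2)]
          rw [le_antisymm h2 (abs_nonneg _), zero_mul]
      · rw [intervalIntegrable_iff_integrableOn_Ioc_of_le hab]
        exact (integrableOn_const (by simp)).indicator hSm
    refine h1.trans ?_
    rw [intervalIntegral.integral_of_le hab]
    have h4 : ∫ t in Ioc a b, S.indicator (fun _ => B) t ≤ ∫ t, S.indicator (fun _ => B) t := by
      refine setIntegral_le_integral ?_ ?_
      · exact (integrable_indicator_iff hSm).2 (integrableOn_const hSfin)
      · exact Filter.Eventually.of_forall fun t => indicator_nonneg (fun _ _ => hB) t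
    refine h4.trans (le_of_eq ?_)
    rw [integral_indicator hSm, setIntegral_const, smul_eq_mul, mul_comm]
  have hbv : ‖∫ t in a..b, v' t * e t‖ ≤ B * (4 * (d * Real.pi / μ)) + B * (2 / μ) * 2 := by
    have hqc : Continuous fun t => |q.derivative.eval t| / ((q.eval t) ^ 2 + μ ^ 2) :=
      Continuous.div (by fun_prop) (by fun_prop) (fun t => by positivity)
    have h1 : ‖∫ t in a..b, v' t * e t‖ ≤ ∫ t in a..b,
        (B * 4 * (|q.derivative.eval t| / ((q.eval t) ^ 2 + μ ^ 2)) + B * (2 / μ)) := by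
      refine intervalIntegral.norm_integral_le_of_norm_le hab ?_ ?_
      · filter_upwards [hnb] with t htb ht
        have ht' : t ∈ Icc a b := Ioc_subset_Icc_self ht
        have ht'' : t ∈ Ioo a b := ⟨ht.1, lt_of_le_of_ne ht.2 htb⟩
        rw [norm_mul, henorm, mul_one]
        simp only [hv']
        rw [Complex.norm_real, Real.norm_eq_abs]
        refine (abs_add_le _ _).trans ?_
        rw [abs_mul (g' t) (ψ t), abs_mul (g t) (deriv ψ t)]
        have i1 := mul_le_mul (hgle' t) (hψB t ht') (abs_nonneg _) ((abs_nonneg _).trans (hgle' t))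
        have i2 := mul_le_mul (hgle t) (hψB' t ht'') (abs_nonneg _) ((abs_nonneg _).trans (hgle t))
        linarith
      · exact ((continuous_const.mul hqc).add continuous_const).intervalIntegrable _ _
    refine h1.trans ?_
    have hqi : IntervalIntegrable (fun t => B * 4 * (|q.derivative.eval t|
        / ((q.eval t) ^ 2 + μ ^ 2))) volume a b := (continuous_const.mul hqc).intervalIntegrable _ _
    rw [intervalIntegral.integral_add hqi
      (continuous_const.intervalIntegrable _ _), intervalIntegral.integral_const_mul,
      intervalIntegral.integral_const, smul_eq_mul]
    have h2 := vdc_logderiv d q hqdeg μ hμ a b hab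
    have h3 := mul_le_mul_of_nonneg_left h2 (by positivity : 0 ≤ B * 4)
    have h4 := mul_le_mul_of_nonneg_right hab2 (by positivity : 0 ≤ B * (2 / μ))
    linarith
  have hvb : ∀ t ∈ Icc a b, ‖v t * e t‖ ≤ 2 / μ * B := by
    intro t ht
    rw [norm_mul, henorm, mul_one]
    simp only [hv]
    rw [Complex.norm_real, Real.norm_eq_abs, abs_mul]
    exact mul_le_mul (hgle t) (hψB t ht) (abs_nonneg _) (by positivity)
  rw [hsplit, hparts]
  refine (norm_add_le _ _).trans ?_
  rw [norm_mul, norm_neg, Complex.norm_I, one_mul]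
  have k1 := norm_sub_le (v b * e b - v a * e a) (∫ t in a..b, v' t * e t)
  have k2 := norm_sub_le (v b * e b) (v a * e a)
  have k3 := hvb a ⟨le_rfl, hab⟩
  have k4 := hvb b ⟨hab, le_rfl⟩
  have k5 : B * ((8 + 4 * Real.pi * d) / μ) = 2 / μ * B + 2 / μ * B
      + (B * (4 * (d * Real.pi / μ)) + B * (2 / μ) * 2) := by ring
  rw [k5]
  linarith

theorem vdc_eval_aeval {n : ℕ} (Q : MvPolynomial (Fin n) ℝ) (f : Fin n → Polynomial ℝ) (s : ℝ) :
    (MvPolynomial.aeval f Q).eval s = MvPolynomial.eval (fun i => (f i).eval s) Q := by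
  induction Q using MvPolynomial.induction_on with
  | C a => simp
  | add p q hp hq => simp [hp, hq]
  | mul_X p i hp => simp [hp]

theorem vdc_continuous_eval {n : ℕ} (Q : MvPolynomial (Fin n) ℝ) :
    Continuous (fun x : Fin n → ℝ => MvPolynomial.eval x Q) :=
  MvPolynomial.continuous_eval Q

/-- Multi-dimensional sublevel set estimate. -/
theorem vdc_sublevel (n m : ℕ) (Q : MvPolynomial (Fin n) ℝ) (hQ : Q.totalDegree ≤ m)
    (x0 : EuclideanSpace ℝ (Fin n)) (hx0 : x0 ∈ Metric.closedBall (0 : EuclideanSpace ℝ (Fin n)) 1)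
    (M : ℝ) (hM : M ≤ |MvPolynomial.eval (fun i => x0 i) Q|) (ε : ℝ) (hε : 0 < ε) :
    volume {x : EuclideanSpace ℝ (Fin n) | x ∈ Metric.closedBall (0 : EuclideanSpace ℝ (Fin n)) 1 ∧
        |MvPolynomial.eval (fun i => x i) Q| < ε ^ m * M}
      ≤ 2 * (ENNReal.ofReal ((4 * m + 2) * ε) *
          volume (Metric.closedBall (0 : EuclideanSpace ℝ (Fin n)) 4)) := by
  set E : Set (EuclideanSpace ℝ (Fin n)) :=
    {x | x ∈ Metric.closedBall (0 : EuclideanSpace ℝ (Fin n)) 1 ∧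
        |MvPolynomial.eval (fun i => x i) Q| < ε ^ m * M} with hE
  have hQc : Continuous fun x : EuclideanSpace ℝ (Fin n) => MvPolynomial.eval (fun i => x i) Q :=
    (vdc_continuous_eval Q).comp (by fun_prop)
  have hEm : MeasurableSet E := by
    refine measurableSet_closedBall.inter ?_
    exact (isOpen_lt (f := fun x : EuclideanSpace ℝ (Fin n) =>
      |MvPolynomial.eval (fun i => x i) Q|) (g := fun _ => ε ^ m * M)
      (continuous_abs.comp hQc) continuous_const).measurableSet
  set F : Set (ℝ × EuclideanSpace ℝ (Fin n)) :=
    (Icc (1/2 : ℝ) 1 ×ˢ Metric.closedBall (0 : EuclideanSpace ℝ (Fin n)) 4) ∩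
      (fun z : ℝ × EuclideanSpace ℝ (Fin n) => x0 + z.1 • z.2) ⁻¹' E with hF
  have hFm : MeasurableSet F := by
    refine (measurableSet_Icc.prod measurableSet_closedBall).inter ?_
    exact (by fun_prop : Continuous fun z : ℝ × EuclideanSpace ℝ (Fin n) =>
      x0 + z.1 • z.2).measurable hEm
  have hlow : ∀ s ∈ Icc (1/2 : ℝ) 1, volume E ≤ volume (Prod.mk s ⁻¹' F) := by
    intro s hs
    have hs0 : 0 < s := by linarith [hs.1]
    have h1 : Prod.mk s ⁻¹' F = (fun x => s • x) ⁻¹' ((fun x => x0 + x) ⁻¹' E) := by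
      ext v
      simp only [hF, mem_preimage, mem_inter_iff, mem_prod]
      refine ⟨fun h => h.2, fun h => ⟨⟨hs, ?_⟩, h⟩⟩
      have h2 := h.1
      rw [mem_closedBall_zero_iff] at h2 hx0 ⊢
      have h3 : ‖s • v‖ ≤ ‖x0 + s • v‖ + ‖x0‖ := by
        have := norm_sub_le (x0 + s • v) x0
        simpa using this
      rw [norm_smul, Real.norm_eq_abs, abs_of_pos hs0] at h3
      nlinarith [norm_nonneg v, hs.1]
    rw [h1, Measure.addHaar_preimage_smul _ hs0.ne', measure_preimage_add]
    have h4 : 1 ≤ ENNReal.ofReal |(s ^ Module.finrank ℝ (EuclideanSpace ℝ (Fin n)))⁻¹| := by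
      rw [← ENNReal.ofReal_one]
      apply ENNReal.ofReal_le_ofReal
      rw [abs_of_pos (by positivity)]
      exact (one_le_inv₀ (by positivity)).2 (pow_le_one₀ hs0.le hs.2)
    calc volume E = 1 * volume E := (one_mul _).symm
      _ ≤ _ := by gcongr
  have hup : ∀ v : EuclideanSpace ℝ (Fin n), volume ((fun s => (s, v)) ⁻¹' F) ≤
      (Metric.closedBall (0 : EuclideanSpace ℝ (Fin n)) 4).indicator
        (fun _ => ENNReal.ofReal ((4 * m + 2) * ε)) v := by
    intro v
    by_cases hv : v ∈ Metric.closedBall (0 : EuclideanSpace ℝ (Fin n)) 4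
    · rw [indicator_of_mem hv]
      set f : Fin n → Polynomial ℝ := fun i => Polynomial.C (x0 i) + Polynomial.X * Polynomial.C (v i)
        with hf
      set p : Polynomial ℝ := MvPolynomial.aeval f Q with hp
      have hpd : p.natDegree ≤ m := by
        have := MvPolynomial.aeval_natDegree_le (n := 1) Q hQ f (fun i => by
          simp only [hf]
          refine (Polynomial.natDegree_add_le _ _).trans ?_
          simp only [Polynomial.natDegree_C, zero_le, sup_of_le_right]
          exact (Polynomial.natDegree_mul_C_le _ _).trans Polynomial.natDegree_X_le)
        simpa using this
      have hpe : ∀ s : ℝ, (p.map (algebraMap ℝ ℂ)).eval (s:ℂ)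
          = ((MvPolynomial.eval (fun i => (x0 + s • v) i) Q : ℝ) : ℂ) := by
        intro s
        rw [Polynomial.eval_map]
        have h1 : Polynomial.eval₂ (algebraMap ℝ ℂ) (s:ℂ) p = ((p.eval s : ℝ) : ℂ) :=
          Polynomial.eval₂_at_apply (algebraMap ℝ ℂ) s
        rw [h1, hp, vdc_eval_aeval]
        congr 3
        funext i
        simp only [hf, Polynomial.eval_add, Polynomial.eval_mul, Polynomial.eval_C,
          Polynomial.eval_X, PiLp.add_apply, PiLp.smul_apply, smul_eq_mul]
      refine le_trans (measure_mono ?_) (vdc_remez m (p.map (algebraMap ℝ ℂ))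
        ((Polynomial.natDegree_map_le).trans hpd) ε hε)
      rintro s ⟨⟨hs, _⟩, hsE⟩
      refine ⟨⟨by linarith [hs.1], hs.2⟩, ?_⟩
      have h0 := hpe 0
      simp only [Complex.ofReal_zero, zero_smul, add_zero] at h0
      rw [hpe, h0, Complex.norm_real, Complex.norm_real, Real.norm_eq_abs, Real.norm_eq_abs]
      exact lt_of_lt_of_le hsE.2 (by gcongr)
    · rw [indicator_of_notMem hv]
      have : (fun s => (s, v)) ⁻¹' F = ∅ := by
        ext s
        simp only [hF, mem_preimage, mem_inter_iff, mem_prod, mem_empty_iff_false, iff_false]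
        exact fun h => hv h.1.2
      rw [this]; simp
  have k1 : ENNReal.ofReal (1/2) * volume E ≤ (volume.prod volume) F := by
    rw [Measure.prod_apply hFm]
    calc _ = ∫⁻ s in Icc (1/2 : ℝ) 1, volume E := by
          rw [setLIntegral_const, Real.volume_Icc, mul_comm]; norm_num
      _ ≤ ∫⁻ s in Icc (1/2 : ℝ) 1, volume (Prod.mk s ⁻¹' F) :=
          setLIntegral_mono' measurableSet_Icc hlow
      _ ≤ _ := setLIntegral_le_lintegral _ _
  have k2 : (volume.prod volume) F ≤ ENNReal.ofReal ((4 * m + 2) * ε) *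
          volume (Metric.closedBall (0 : EuclideanSpace ℝ (Fin n)) 4) := by
    rw [Measure.prod_apply_symm hFm]
    refine (lintegral_mono hup).trans ?_
    rw [lintegral_indicator measurableSet_closedBall, setLIntegral_const]
  calc volume E = 2 * (ENNReal.ofReal (1/2) * volume E) := by
        rw [← mul_assoc]
        have : (2 : ENNReal) * ENNReal.ofReal (1/2) = 1 := by
          rw [← ENNReal.ofReal_ofNat, ← ENNReal.ofReal_mul (by norm_num)]; norm_num
        rw [this, one_mul]
    _ ≤ _ := mul_le_mul' le_rfl (k1.trans k2)

/-- The polynomial as an `MvPolynomial`. -/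
noncomputable def vdcP (n d : ℕ) : ((Fin n → Fin (d + 1)) → ℝ) →ₗ[ℝ] MvPolynomial (Fin n) ℝ where
  toFun lam := ∑ α, MvPolynomial.monomial (Finsupp.equivFunOnFinite.symm fun i => (α i : ℕ)) (lam α)
  map_add' a b := by simp [Finset.sum_add_distrib]
  map_smul' c a := by simp [Finset.smul_sum, MvPolynomial.smul_monomial]

theorem vdcP_eval {n d : ℕ} (lam : (Fin n → Fin (d + 1)) → ℝ) (x : EuclideanSpace ℝ (Fin n)) :
    MvPolynomial.eval (fun i => x i) (vdcP n d lam) = mpoly lam x := by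
  simp only [vdcP, mpoly, LinearMap.coe_mk, AddHom.coe_mk, map_sum]
  refine Finset.sum_congr rfl fun α _ => ?_
  rw [MvPolynomial.eval_monomial, Finsupp.prod_fintype _ _ (fun i => pow_zero _)]
  rfl

theorem vdcP_coeff {n d : ℕ} (lam : (Fin n → Fin (d + 1)) → ℝ) (α : Fin n → Fin (d + 1)) :
    MvPolynomial.coeff (Finsupp.equivFunOnFinite.symm fun i => (α i : ℕ)) (vdcP n d lam) = lam α := by
  classical
  simp only [vdcP, LinearMap.coe_mk, AddHom.coe_mk, MvPolynomial.coeff_sum,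
    MvPolynomial.coeff_monomial]
  rw [Finset.sum_eq_single α]
  · simp
  · intro β _ hβ
    rw [if_neg]
    intro h
    apply hβ
    have := Finsupp.equivFunOnFinite.symm.injective h
    funext i
    exact Fin.ext (congrFun this i)
  · simp

theorem vdcP_totalDegree {n d : ℕ} (lam : (Fin n → Fin (d + 1)) → ℝ)
    (h : ∀ α, (mdeg α < 1 ∨ d < mdeg α) → lam α = 0) : (vdcP n d lam).totalDegree ≤ d := by
  simp only [vdcP, LinearMap.coe_mk, AddHom.coe_mk]
  refine MvPolynomial.totalDegree_finsetSum_le fun α _ => ?_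
  by_cases hα : lam α = 0
  · simp [hα]
  · rw [MvPolynomial.totalDegree_monomial _ hα, Finsupp.sum_fintype _ _ (fun _ => rfl)]
    by_contra hc
    push Not at hc
    exact hα (h α (Or.inr hc))

theorem vdc_totalDegree_pderiv {n d : ℕ} (P : MvPolynomial (Fin n) ℝ) (hP : P.totalDegree ≤ d)
    (j : Fin n) : (MvPolynomial.pderiv j P).totalDegree ≤ d - 1 := by
  classical
  refine Finset.sup_le fun m hm => ?_
  rw [MvPolynomial.mem_support_iff, MvPolynomial.coeff_pderiv] at hm
  have h1 : m + Finsupp.single j 1 ∈ P.support :=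
    MvPolynomial.mem_support_iff.2 (left_ne_zero_of_mul hm)
  have h2 := (MvPolynomial.le_totalDegree h1).trans hP
  rw [Finsupp.sum_add_index' (fun _ => rfl) (fun _ _ _ => rfl), Finsupp.sum_single_index rfl] at h2
  omega

theorem vdc_derivative_aeval {n : ℕ} (P : MvPolynomial (Fin n) ℝ) (j : Fin n)
    (f : Fin n → Polynomial ℝ) (hf : ∀ i, (f i).derivative = if i = j then 1 else 0) :
    (MvPolynomial.aeval f P).derivative = MvPolynomial.aeval f (MvPolynomial.pderiv j P) := by
  classical
  induction P using MvPolynomial.induction_on with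
  | C a => simp
  | add p q hp hq => simp [hp, hq]
  | mul_X p i hp =>
    simp only [map_mul, MvPolynomial.aeval_X, Polynomial.derivative_mul, hp, hf,
      MvPolynomial.pderiv_mul, map_add, MvPolynomial.pderiv_X, Pi.single_apply]
    split_ifs <;> simp_all

/-- Restriction of a polynomial to the closed unit ball as a continuous function. -/
noncomputable def vdcR (n : ℕ) : MvPolynomial (Fin n) ℝ →ₗ[ℝ]
    C(Metric.closedBall (0 : EuclideanSpace ℝ (Fin n)) 1, ℝ) where
  toFun Q := ⟨fun x => MvPolynomial.eval (fun i => x.1 i) Q,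
    (vdc_continuous_eval Q).comp (by fun_prop)⟩
  map_add' a b := by ext; simp
  map_smul' c a := by ext; simp

theorem vdcR_injective (n : ℕ) (Q : MvPolynomial (Fin n) ℝ) (h : vdcR n Q = 0) : Q = 0 := by
  refine MvPolynomial.funext_set (fun _ => Icc (0:ℝ) (1 / (n + 1)))
    (fun _ => Icc_infinite (by positivity)) fun x hx => ?_
  rw [map_zero]
  have hmem : WithLp.toLp 2 x ∈ Metric.closedBall (0 : EuclideanSpace ℝ (Fin n)) 1 := by
    rw [mem_closedBall_zero_iff, EuclideanSpace.norm_eq, Real.sqrt_le_one]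
    have h1 : ∀ i ∈ Finset.univ, ‖x i‖ ^ 2 ≤ 1 / ((n:ℝ) + 1) := by
      intro i _
      have := hx i (mem_univ i)
      have h3 : (1:ℝ) / (n + 1) ≤ 1 := by
        rw [div_le_one (by positivity)]; linarith [Nat.cast_nonneg (α := ℝ) n]
      rw [Real.norm_eq_abs, sq_abs]
      nlinarith [this.1, this.2]
    refine (Finset.sum_le_sum h1).trans ?_
    rw [Finset.sum_const, Finset.card_univ, Fintype.card_fin, nsmul_eq_mul, mul_one_div,
      div_le_one (by positivity)]
    linarith
  have := congrArg (fun f => f ⟨WithLp.toLp 2 x, hmem⟩) h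
  exact this

theorem vdc_lower (n d : ℕ) : ∃ c : ℝ, 0 < c ∧ ∀ lam : (Fin n → Fin (d + 1)) → ℝ,
    lam 0 = 0 → (0 < ∑ α : Fin n → Fin (d + 1), |lam α|) →
    ∃ j : Fin n, ∃ x0 ∈ Metric.closedBall (0 : EuclideanSpace ℝ (Fin n)) 1,
      c * (∑ α : Fin n → Fin (d + 1), |lam α|)
        ≤ |MvPolynomial.eval (fun i => x0 i) (MvPolynomial.pderiv j (vdcP n d lam))| := by
  classical
  have : CompactSpace (Metric.closedBall (0 : EuclideanSpace ℝ (Fin n)) 1) :=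
    isCompact_iff_compactSpace.1 (isCompact_closedBall _ _)
  set Lm : ((Fin n → Fin (d + 1)) → ℝ) →ₗ[ℝ]
      ℝ × (Fin n → C(Metric.closedBall (0 : EuclideanSpace ℝ (Fin n)) 1, ℝ)) :=
    (LinearMap.proj 0).prod (LinearMap.pi fun j =>
      vdcR n ∘ₗ (MvPolynomial.pderiv j).toLinearMap ∘ₗ vdcP n d) with hLm
  have hker : Lm.ker = ⊥ := by
    rw [LinearMap.ker_eq_bot']
    intro lam hlam
    have h0 : lam 0 = 0 := congrArg Prod.fst hlam
    have hj : ∀ j, MvPolynomial.pderiv j (vdcP n d lam) = 0 := fun j =>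
      vdcR_injective n _ (congrFun (congrArg Prod.snd hlam) j)
    funext α
    by_cases hα : α = 0
    · rw [hα, h0]; rfl
    · obtain ⟨j, hjα⟩ := Function.ne_iff.1 hα
      have hpos : 1 ≤ (α j : ℕ) := by
        rcases Nat.eq_zero_or_pos (α j : ℕ) with h | h
        · exact absurd (Fin.ext h) hjα
        · exact h
      set a : Fin n →₀ ℕ := Finsupp.equivFunOnFinite.symm fun i => (α i : ℕ) with ha
      have h1 := MvPolynomial.coeff_pderiv (i := j) (vdcP n d lam) (a - Finsupp.single j 1)
      have h2 : a - Finsupp.single j 1 + Finsupp.single j 1 = a := by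
        refine tsub_add_cancel_of_le ?_
        rw [Finsupp.single_le_iff]
        exact hpos
      rw [hj j, h2, ha, vdcP_coeff, MvPolynomial.coeff_zero] at h1
      have h3 := h1.symm
      rcases mul_eq_zero.1 h3 with h | h
      · exact h
      · exfalso
        exact absurd h (by positivity)
  obtain ⟨K, hK, hanti⟩ := Lm.exists_antilipschitzWith hker
  set N : ℝ := ((Fintype.card (Fin n → Fin (d + 1)) : ℕ) : ℝ) with hN
  have hNpos : 0 < N := by
    rw [hN]; exact_mod_cast Fintype.card_pos
  have hKpos : (0:ℝ) < K := hK
  refine ⟨1 / (N * K), by positivity, fun lam h0 hpos => ?_⟩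
  set S := ∑ α : Fin n → Fin (d + 1), |lam α| with hS
  by_contra hcon
  push Not at hcon
  have hcpos : 0 < 1 / (N * K) * S := by positivity
  have h1 : ‖Lm lam‖ < 1 / (N * K) * S := by
    rw [Prod.norm_def, max_lt_iff]
    constructor
    · have : (Lm lam).1 = 0 := h0
      rw [this, norm_zero]; exact hcpos
    · rw [pi_norm_lt_iff hcpos]
      intro j
      rw [ContinuousMap.norm_lt_iff _ hcpos]
      intro x
      exact hcon j x.1 x.2
  have h2 : ‖lam‖ ≤ K * ‖Lm lam‖ := by
    have := hanti.le_mul_dist lam 0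
    simpa [dist_zero_right] using this
  have h3 : S ≤ N * ‖lam‖ := by
    calc S ≤ ∑ α : Fin n → Fin (d + 1), ‖lam‖ :=
          Finset.sum_le_sum fun α _ => norm_le_pi_norm lam α
      _ = _ := by rw [Finset.sum_const, nsmul_eq_mul, Finset.card_univ]
  have h4 : N * ‖lam‖ < S := by
    calc N * ‖lam‖ ≤ N * (K * ‖Lm lam‖) := by gcongr
      _ < N * (K * (1 / (N * K) * S)) := by gcongr
      _ = S := by field_simp
  linarith

theorem vdc_slice {n d : ℕ} (lam : (Fin n → Fin (d + 1)) → ℝ)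
    (hlam : (vdcP n d lam).totalDegree ≤ d) (j : Fin n) (μ : ℝ) (hμ : 0 < μ)
    (φ : EuclideanSpace ℝ (Fin n) → ℝ)
    (hφ : ContDiffOn ℝ 1 φ (Metric.closedBall (0 : EuclideanSpace ℝ (Fin n)) 1))
    (W : Set (EuclideanSpace ℝ (Fin n))) (hW : Convex ℝ W) (hWo : IsOpen W)
    (hWs : W ⊆ Metric.closedBall (0 : EuclideanSpace ℝ (Fin n)) 1) (B : ℝ)
    (hB : ∀ x ∈ Metric.closedBall (0 : EuclideanSpace ℝ (Fin n)) 1, |φ x| + ‖fderiv ℝ φ x‖ ≤ B)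
    (x1 : EuclideanSpace ℝ (Fin n)) :
    ‖∫ t : ℝ, W.indicator (fun x => Complex.exp (Complex.I * (mpoly lam x : ℂ)) * (φ x : ℂ))
        (x1 + t • EuclideanSpace.single j (1:ℝ))‖ₑ
      ≤ ENNReal.ofReal (B * ((8 + 4 * Real.pi * d) / μ)) + ENNReal.ofReal B *
        volume {t : ℝ | x1 + t • EuclideanSpace.single j (1:ℝ) ∈
          {x : EuclideanSpace ℝ (Fin n) | x ∈ Metric.closedBall (0 : EuclideanSpace ℝ (Fin n)) 1 ∧
            |MvPolynomial.eval (fun i => x i) (MvPolynomial.pderiv j (vdcP n d lam))| < μ}} := by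
  classical
  set F : EuclideanSpace ℝ (Fin n) → ℂ :=
    fun x => Complex.exp (Complex.I * (mpoly lam x : ℂ)) * (φ x : ℂ) with hF
  set l : ℝ → EuclideanSpace ℝ (Fin n) := fun t => x1 + t • EuclideanSpace.single j (1:ℝ) with hl
  have hlc : Continuous l := by fun_prop
  have hB0 : 0 ≤ B := (add_nonneg (abs_nonneg _) (norm_nonneg _)).trans
    (hB 0 (Metric.mem_closedBall_self zero_le_one))
  have hconv : ∀ A : Set (EuclideanSpace ℝ (Fin n)), Convex ℝ A → Convex ℝ (l ⁻¹' A) := by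
    intro A hA s hs t ht a b ha hb hab
    have : l (a • s + b • t) = a • l s + b • l t := by
      simp only [hl, smul_add, smul_smul, smul_eq_mul, add_smul]
      have : x1 = a • x1 + b • x1 := by rw [← add_smul, hab, one_smul]
      nth_rw 1 [this]
      abel
    rw [mem_preimage, this]
    exact hA hs ht ha hb hab
  set I : Set ℝ := l ⁻¹' W with hI
  have hIm : MeasurableSet I := (hWo.preimage hlc).measurableSet
  rcases I.eq_empty_or_nonempty with hIe | hIne
  · have h0 : ∀ t, W.indicator F (l t) = 0 := by
      intro t
      have ht : l t ∉ W := by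
        intro h
        have h' : t ∈ I := h
        rw [hIe] at h'
        exact h'
      exact indicator_of_notMem ht _
    have h00 : ‖∫ t : ℝ, W.indicator F (l t)‖ₑ = 0 := by
      simp only [h0, integral_zero, enorm_zero]
    exact h00.le.trans (zero_le (a := _))
  set J : Set ℝ := l ⁻¹' (Metric.closedBall (0 : EuclideanSpace ℝ (Fin n)) 1) with hJ
  have hJc : IsClosed J := Metric.isClosed_closedBall.preimage hlc
  have hIJ : I ⊆ J := fun t ht => hWs ht
  have hJb : J ⊆ Icc (-1 - x1 j) (1 - x1 j) := by
    intro t ht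
    have h1 : ‖l t‖ ≤ 1 := mem_closedBall_zero_iff.1 ht
    have h2 : ‖(l t) j‖ ≤ ‖l t‖ := PiLp.norm_apply_le _ _
    have h3 : (l t) j = x1 j + t := by simp [hl]
    rw [h3, Real.norm_eq_abs] at h2
    have := abs_le.1 (h2.trans h1)
    constructor <;> linarith [this.1, this.2]
  have hbb : BddBelow I := ⟨_, fun t ht => (hJb (hIJ ht)).1⟩
  have hba : BddAbove I := ⟨_, fun t ht => (hJb (hIJ ht)).2⟩
  set a := sInf I with ha
  set b := sSup I with hb
  have haJ : a ∈ J := hJc.closure_subset_iff.2 hIJ (csInf_mem_closure hIne hbb)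
  have hbJ : b ∈ J := hJc.closure_subset_iff.2 hIJ (csSup_mem_closure hIne hba)
  have hab : a ≤ b := csInf_le_csSup hIne hbb hba
  have hab2 : b - a ≤ 2 := by linarith [(hJb haJ).1, (hJb hbJ).2]
  have hIccJ : Icc a b ⊆ J :=
    ((hconv _ (convex_closedBall 0 1)).ordConnected).out haJ hbJ
  have hIsub : I ⊆ Icc a b := fun t ht => ⟨csInf_le hbb ht, le_csSup hba ht⟩
  have hIoo : Ioo a b ⊆ I :=
    IsConnected.Ioo_csInf_csSup_subset ⟨hIne, (hconv W hW).isPreconnected⟩ hbb hba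
  set f : Fin n → Polynomial ℝ := fun i => Polynomial.C (x1 i)
    + Polynomial.C (EuclideanSpace.single j (1:ℝ) i) * Polynomial.X with hf
  have hfe : ∀ t, (fun i => (f i).eval t) = fun i => (l t) i := by
    intro t
    funext i
    simp only [hf, hl, Polynomial.eval_add, Polynomial.eval_mul, Polynomial.eval_C,
      Polynomial.eval_X, PiLp.add_apply, PiLp.smul_apply, smul_eq_mul]
    ring
  set p : Polynomial ℝ := MvPolynomial.aeval f (vdcP n d lam) with hp
  have hpd : p.natDegree ≤ d := by
    have := MvPolynomial.aeval_natDegree_le (n := 1) _ hlam f (fun i => by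
      simp only [hf]
      refine (Polynomial.natDegree_add_le _ _).trans ?_
      simp only [Polynomial.natDegree_C, zero_le, sup_of_le_right]
      exact (Polynomial.natDegree_C_mul_le _ _).trans Polynomial.natDegree_X_le)
    simpa using this
  have hpe : ∀ t, p.eval t = mpoly lam (l t) := by
    intro t; rw [hp, vdc_eval_aeval, hfe, vdcP_eval]
  have hpe' : ∀ t, p.derivative.eval t
      = MvPolynomial.eval (fun i => (l t) i) (MvPolynomial.pderiv j (vdcP n d lam)) := by
    intro t
    rw [hp, vdc_derivative_aeval _ j f, vdc_eval_aeval, hfe]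
    intro i
    simp only [hf]
    by_cases hij : i = j <;> simp [hij]
  have hdiff : ∀ t ∈ Ioo a b, DifferentiableAt ℝ φ (l t) := by
    intro t ht
    have h1 : l t ∈ W := hIoo ht
    have h2 : Metric.closedBall (0 : EuclideanSpace ℝ (Fin n)) 1 ∈ nhds (l t) :=
      Filter.mem_of_superset (hWo.mem_nhds h1) hWs
    exact (hφ.differentiableOn (by norm_num)).differentiableAt h2
  have hld : ∀ t, HasDerivAt l (EuclideanSpace.single j (1:ℝ)) t := by
    intro t
    have := ((hasDerivAt_id t).smul_const (EuclideanSpace.single j (1:ℝ))).const_add x1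
    rw [one_smul] at this
    exact this
  have hψd : ∀ t ∈ Ioo a b, HasDerivAt (fun t => φ (l t))
      (fderiv ℝ φ (l t) (EuclideanSpace.single j (1:ℝ))) t := fun t ht =>
    (hdiff t ht).hasFDerivAt.comp_hasDerivAt t (hld t)
  have hmain := vdc_oneD d p hpd μ hμ a b hab hab2 (fun t => φ (l t)) B
    (hφ.continuousOn.comp hlc.continuousOn hIccJ)
    (fun t ht => (hψd t ht).differentiableAt)
    (fun t ht => (le_add_of_nonneg_right (norm_nonneg _)).trans (hB _ (hIccJ ht)))
    (fun t ht => by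
      rw [(hψd t ht).deriv]
      have h1 := (fderiv ℝ φ (l t)).le_opNorm (EuclideanSpace.single j (1:ℝ))
      rw [PiLp.norm_single, norm_one, mul_one] at h1
      exact h1.trans ((le_add_of_nonneg_left (abs_nonneg _)).trans
        (hB _ (hIccJ (Ioo_subset_Icc_self ht)))))
  have hslice_eq : ∫ t : ℝ, W.indicator F (l t)
      = ∫ t in a..b, Complex.exp (Complex.I * ((p.eval t : ℝ) : ℂ)) * ((φ (l t) : ℝ) : ℂ) := by
    have e1 : (fun t => W.indicator F (l t)) = I.indicator (fun t => F (l t)) := by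
      funext t
      by_cases ht : l t ∈ W
      · rw [indicator_of_mem ht, indicator_of_mem (show t ∈ I from ht)]
      · rw [indicator_of_notMem ht, indicator_of_notMem (show t ∉ I from ht)]
    rw [e1, integral_indicator hIm, intervalIntegral.integral_of_le hab]
    have e2 : I =ᵐ[volume] Ioc a b := by
      refine Filter.EventuallyLE.antisymm ?_ ?_
      · exact (HasSubset.Subset.eventuallyLE hIsub).trans Ioc_ae_eq_Icc.symm.le
      · exact Ioo_ae_eq_Ioc.symm.le.trans (HasSubset.Subset.eventuallyLE hIoo)
    rw [setIntegral_congr_set e2]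
    congr 1
    funext t
    simp only [hF, hpe]
  rw [hslice_eq]
  set S := {t | t ∈ Icc a b ∧ |p.derivative.eval t| < μ} with hS
  have hSfin : volume S ≠ ⊤ :=
    ((measure_mono (fun t ht => ht.1)).trans_lt (measure_Icc_lt_top (a := a) (b := b))).ne
  rw [← ofReal_norm]
  refine (ENNReal.ofReal_le_ofReal hmain).trans ?_
  rw [ENNReal.ofReal_add (by positivity) (by positivity), ENNReal.ofReal_mul (p := B)
    (q := volume.real S) hB0, ofReal_measureReal hSfin]
  gcongr
  rintro t ⟨ht, ht2⟩
  refine ⟨hIccJ ht, ?_⟩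
  rw [hpe'] at ht2
  exact ht2


/-- Fubini: integrate the slice estimate over the remaining coordinates. -/
theorem vdc_fubini {k d : ℕ} (lam : (Fin (k + 1) → Fin (d + 1)) → ℝ)
    (hlam : (vdcP (k + 1) d lam).totalDegree ≤ d) (j : Fin (k + 1)) (μ : ℝ) (hμ : 0 < μ)
    (φ : EuclideanSpace ℝ (Fin (k + 1)) → ℝ)
    (hφ : ContDiffOn ℝ 1 φ (Metric.closedBall (0 : EuclideanSpace ℝ (Fin (k + 1))) 1))
    (W : Set (EuclideanSpace ℝ (Fin (k + 1)))) (hW : Convex ℝ W) (hWo : IsOpen W)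
    (hWs : W ⊆ Metric.closedBall (0 : EuclideanSpace ℝ (Fin (k + 1))) 1) (B : ℝ)
    (hB : ∀ x ∈ Metric.closedBall (0 : EuclideanSpace ℝ (Fin (k + 1))) 1,
      |φ x| + ‖fderiv ℝ φ x‖ ≤ B) :
    ‖∫ x, W.indicator (fun x => Complex.exp (Complex.I * (mpoly lam x : ℂ)) * (φ x : ℂ)) x‖ₑ
      ≤ ENNReal.ofReal (B * ((8 + 4 * Real.pi * d) / μ)) * ENNReal.ofReal (2 ^ k)
        + ENNReal.ofReal B * volume {x : EuclideanSpace ℝ (Fin (k + 1)) |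
            x ∈ Metric.closedBall (0 : EuclideanSpace ℝ (Fin (k + 1))) 1 ∧
            |MvPolynomial.eval (fun i => x i) (MvPolynomial.pderiv j (vdcP (k + 1) d lam))| < μ} := by
  classical
  set F : EuclideanSpace ℝ (Fin (k + 1)) → ℂ :=
    fun x => Complex.exp (Complex.I * (mpoly lam x : ℂ)) * (φ x : ℂ) with hF
  set E : Set (EuclideanSpace ℝ (Fin (k + 1))) :=
    {x | x ∈ Metric.closedBall (0 : EuclideanSpace ℝ (Fin (k + 1))) 1 ∧
            |MvPolynomial.eval (fun i => x i) (MvPolynomial.pderiv j (vdcP (k + 1) d lam))| < μ}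
    with hE
  have hQc : Continuous fun x : EuclideanSpace ℝ (Fin (k + 1)) =>
      MvPolynomial.eval (fun i => x i) (MvPolynomial.pderiv j (vdcP (k + 1) d lam)) :=
    (vdc_continuous_eval _).comp (by fun_prop)
  have hEm : MeasurableSet E := by
    refine measurableSet_closedBall.inter ?_
    exact (isOpen_lt (f := fun x : EuclideanSpace ℝ (Fin (k + 1)) =>
      |MvPolynomial.eval (fun i => x i) (MvPolynomial.pderiv j (vdcP (k + 1) d lam))|)
      (g := fun _ => μ)
      (continuous_abs.comp hQc) continuous_const).measurableSet
  have hFc : ContinuousOn F (Metric.closedBall (0 : EuclideanSpace ℝ (Fin (k + 1))) 1) := by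
    have h1 : Continuous (fun x : EuclideanSpace ℝ (Fin (k + 1)) => mpoly lam x) := by
      unfold mpoly
      fun_prop
    have h2 : Continuous (fun x : EuclideanSpace ℝ (Fin (k + 1)) =>
      Complex.exp (Complex.I * (mpoly lam x : ℂ))) := by fun_prop
    exact h2.continuousOn.mul (Complex.continuous_ofReal.comp_continuousOn hφ.continuousOn)
  have hFi : Integrable (W.indicator F) := by
    rw [integrable_indicator_iff hWo.measurableSet]
    exact (hFc.integrableOn_compact (isCompact_closedBall _ _)).mono_set hWs
  set T : ℝ × (Fin k → ℝ) ≃ᵐ EuclideanSpace ℝ (Fin (k + 1)) :=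
    (MeasurableEquiv.piFinSuccAbove (fun _ => ℝ) j).symm.trans
      (MeasurableEquiv.toLp 2 (Fin (k + 1) → ℝ)) with hT
  have hTm : MeasurePreserving T ((volume : Measure ℝ).prod (volume : Measure (Fin k → ℝ)))
      volume :=
    ((volume_preserving_piFinSuccAbove (fun _ => ℝ) j).symm).trans
      (PiLp.volume_preserving_toLp (Fin (k + 1)))
  have hTa : ∀ t y, T (t, y) = WithLp.toLp 2 (Fin.insertNth (α := fun _ => ℝ) j t y) := by
    intro t y
    rfl
  have hTt : ∀ t y, T (t, y) = T (0, y) + t • EuclideanSpace.single j (1:ℝ) := by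
    intro t y
    rw [hTa, hTa]
    ext i
    refine Fin.succAboveCases j ?_ (fun i => ?_) i
    · simp
    · simp [Fin.succAbove_ne]
  rw [← hTm.integral_comp', integral_prod_symm (fun z => W.indicator F (T z))
    ((hTm.integrable_comp_emb T.measurableEmbedding).2 hFi)]
  refine (enorm_integral_le_lintegral_enorm _).trans ?_
  set box : Set (Fin k → ℝ) := Icc (fun _ => -1) (fun _ => 1) with hbox
  have hbound : ∀ y : Fin k → ℝ, ‖∫ t : ℝ, W.indicator F (T (t, y))‖ₑ ≤
      box.indicator (fun _ => ENNReal.ofReal (B * ((8 + 4 * Real.pi * d) / μ))) y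
      + ENNReal.ofReal B * volume ((fun t => (t, y)) ⁻¹' (T ⁻¹' E)) := by
    intro y
    by_cases hy : y ∈ box
    · rw [indicator_of_mem hy]
      have := vdc_slice lam hlam j μ hμ φ hφ W hW hWo hWs B hB (T (0, y))
      simp only [← hTt] at this
      exact this
    · have h0 : ∀ t, W.indicator F (T (t, y)) = 0 := by
        intro t
        refine indicator_of_notMem (fun hmem => hy ?_) _
        have h1 : ‖T (t, y)‖ ≤ 1 := mem_closedBall_zero_iff.1 (hWs hmem)
        have h2 : ∀ i, |y i| ≤ 1 := by
          intro i
          have h3 : ‖(T (t, y)) (j.succAbove i)‖ ≤ ‖T (t, y)‖ := PiLp.norm_apply_le _ _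
          have h4 : (T (t, y)) (j.succAbove i) = y i := by
            rw [hTa]; simp
          rw [h4, Real.norm_eq_abs] at h3
          exact h3.trans h1
        exact ⟨fun i => (abs_le.1 (h2 i)).1, fun i => (abs_le.1 (h2 i)).2⟩
      have h00 : ‖∫ t : ℝ, W.indicator F (T (t, y))‖ₑ = 0 := by
        simp only [h0, integral_zero, enorm_zero]
      exact h00.le.trans (zero_le (a := _))
  refine (lintegral_mono hbound).trans ?_
  rw [lintegral_add_left (measurable_const.indicator measurableSet_Icc),
    lintegral_indicator measurableSet_Icc, setLIntegral_const,
    lintegral_const_mul _ (measurable_measure_prodMk_right (T.measurable hEm)),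
    ← Measure.prod_apply_symm (T.measurable hEm), hTm.measure_preimage_equiv]
  have hvol : volume box = ENNReal.ofReal (2 ^ k) := by
    rw [hbox, Real.volume_Icc_pi]
    simp only [Finset.prod_const, Finset.card_univ, Fintype.card_fin]
    rw [ENNReal.ofReal_pow (by norm_num)]
    norm_num
  rw [hvol]


/-- van der Corput oscillatory integral estimate:
`|∫_V e^{iP(x)} φ(x) dx| ≤ C |λ|^{-1/d} sup_{x∈U} (|φ(x)| + |∇φ(x)|)` with
`C = C(n,d)`, uniformly in the polynomial `P`, the `C¹` function `φ` and the
convex set `V ⊆ U`. -/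
theorem stmt5 (n d : ℕ) (hd : 1 ≤ d) :
    ∃ C : ℝ, 0 < C ∧ ∀ lam : (Fin n → Fin (d + 1)) → ℝ,
      (∀ α, (mdeg α < 1 ∨ d < mdeg α) → lam α = 0) →
      (0 < ∑ α : Fin n → Fin (d + 1), |lam α|) →
      ∀ φ : EuclideanSpace ℝ (Fin n) → ℝ,
        ContDiffOn ℝ 1 φ (Metric.closedBall (0 : EuclideanSpace ℝ (Fin n)) 1) →
      ∀ V : Set (EuclideanSpace ℝ (Fin n)), Convex ℝ V →
        V ⊆ Metric.closedBall (0 : EuclideanSpace ℝ (Fin n)) 1 →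
      ∀ B : ℝ,
        (∀ x ∈ Metric.closedBall (0 : EuclideanSpace ℝ (Fin n)) 1,
          |φ x| + ‖fderiv ℝ φ x‖ ≤ B) →
        ‖∫ x in V, Complex.exp (Complex.I * (mpoly lam x : ℂ)) * (φ x : ℂ)‖
          ≤ C * (∑ α : Fin n → Fin (d + 1), |lam α|) ^ (-(1 / (d:ℝ))) * B := by

  classical
  rcases n with _ | k
  · refine ⟨1, one_pos, ?_⟩
    intro lam h0 hpos
    exfalso
    have : ∀ α, lam α = 0 := fun α => h0 α (Or.inl (by simp [mdeg]))
    simp [this] at hpos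
  obtain ⟨c, hc, hlow⟩ := vdc_lower (k + 1) d
  set vB : ℝ := volume.real (Metric.closedBall (0 : EuclideanSpace ℝ (Fin (k + 1))) 4) with hvB
  have hvB0 : 0 ≤ vB := measureReal_nonneg
  have hpi := Real.pi_pos
  refine ⟨(8 + 4 * Real.pi * d) / c * 2 ^ k + 2 * ((4 * ((d - 1 : ℕ) : ℝ) + 2) * vB),
    by positivity, ?_⟩
  intro lam h0 hpos φ hφ V hV hVs B hB
  set S : ℝ := ∑ α : Fin (k + 1) → Fin (d + 1), |lam α| with hS
  have hB0 : 0 ≤ B := (add_nonneg (abs_nonneg _) (norm_nonneg _)).trans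
    (hB 0 (Metric.mem_closedBall_self zero_le_one))
  have hlam := vdcP_totalDegree lam h0
  obtain ⟨j, x0, hx0, hx⟩ := hlow lam (h0 0 (Or.inl (by simp [mdeg]))) hpos
  set ε : ℝ := S ^ (-(1 / (d:ℝ))) with hε
  have hε0 : 0 < ε := Real.rpow_pos_of_pos hpos _
  have hεd : ε ^ d * S = 1 := by
    have hd0 : (d : ℝ) ≠ 0 := by positivity
    rw [hε, ← Real.rpow_natCast, ← Real.rpow_mul hpos.le]
    rw [show -(1 / (d:ℝ)) * d = -1 by field_simp, Real.rpow_neg_one]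
    exact inv_mul_cancel₀ hpos.ne'
  set μ : ℝ := ε ^ (d - 1) * (c * S) with hμ
  have hμ0 : 0 < μ := by positivity
  have hμε : μ * ε = c := by
    have : ε ^ d = ε ^ (d - 1) * ε := by
      rw [← pow_succ, Nat.sub_add_cancel hd]
    rw [this] at hεd
    calc μ * ε = c * (ε ^ (d - 1) * ε * S) := by rw [hμ]; ring
      _ = c := by rw [hεd, mul_one]
  have hinv : 1 / μ = ε / c := by
    rw [div_eq_div_iff hμ0.ne' hc.ne', ← hμε]; ring
  have hWs := interior_subset.trans hVs
  have hfub := vdc_fubini lam hlam j μ hμ0 φ hφ (interior V) hV.interior isOpen_interior hWs B hB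
  have hsub := vdc_sublevel (k + 1) (d - 1) _ (vdc_totalDegree_pderiv _ hlam j) x0 hx0 (c * S) hx
    ε hε0
  rw [← hμ] at hsub
  rw [integral_indicator isOpen_interior.measurableSet,
    setIntegral_congr_set (interior_ae_eq_of_null_frontier (hV.addHaar_frontier volume))] at hfub
  have hvfin : volume (Metric.closedBall (0 : EuclideanSpace ℝ (Fin (k + 1))) 4) ≠ ⊤ :=
    measure_closedBall_lt_top.ne
  have h2e : ∀ z : ℝ, (2 : ENNReal) * ENNReal.ofReal z = ENNReal.ofReal 2 * ENNReal.ofReal z := by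
    intro z
    simp
  have hfin := hfub.trans (add_le_add le_rfl (mul_le_mul_right hsub (ENNReal.ofReal B)))
  rw [← ofReal_measureReal hvfin, ← hvB, ← ENNReal.ofReal_mul (by positivity),
    ← ENNReal.ofReal_mul (by positivity),
    h2e, ← ENNReal.ofReal_mul (by positivity),
    ← ENNReal.ofReal_mul hB0, ← ENNReal.ofReal_add (by positivity) (by positivity),
    ← ofReal_norm, ENNReal.ofReal_le_ofReal_iff (by positivity)] at hfin
  refine hfin.trans (le_of_eq ?_)
  rw [div_eq_mul_one_div (8 + 4 * Real.pi * (d:ℝ)) μ, hinv]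
  ring
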